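/- (Concentration of the free entropy) For every M > 0 there exists a positive constant C such that for all t ∈ [0,1] and all R = (R_u,R_v) ∈ [0,∞)² with ‖R‖ ≤ M, the free entropy Fₙ(t,R) = (1/n) ln Z_{t,R} of the (t,R)-parametrized model satisfies E[ ( Fₙ(t,R) − E Fₙ(t,R) )² ] ≤ C/n. -/

import Mathlib

open MeasureTheory Real Filter Set

noncomputable section

/-- i.i.d. standard Gaussian measure on `Fin n → ℝ`. -/
def stdGaussian (n : ℕ) : Measure (Fin n → ℝ) :=
  Measure.pi fun _ : Fin n => ProbabilityTheory.gaussianReal 0 1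

/-- i.i.d. standard Gaussian measure on matrices `Fin p → Fin q → ℝ`. -/
def stdGaussianMat (p q : ℕ) : Measure (Fin p → Fin q → ℝ) :=
  Measure.pi fun _ : Fin p => stdGaussian q

/-- `P` is the uniform (rotation-invariant) probability measure on the sphere of
radius `r` centered at the origin in `ℝⁿ`. -/
def IsUniformSphere (n : ℕ) (r : ℝ) (P : Measure (Fin n → ℝ)) : Prop :=
  IsProbabilityMeasure P ∧
  (∀ᵐ x ∂P, ∑ i, (x i) ^ 2 = r ^ 2) ∧
  ∀ O : Matrix (Fin n) (Fin n) ℝ, O ∈ Matrix.orthogonalGroup (Fin n) ℝ →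
    P.map (fun x => O.mulVec x) = P

/-- The interpolating Hamiltonian `H_{t,R}(u,v)`, with the observations
`Y^{(t)} = √((1−t)/n) U Vᵀ + Z`, `Ỹ = √(α_v R_v) U + Z̃`, `Ȳ = √(α_u R_u) V + Z̄`
substituted. -/
def interpH (n nu nv : ℕ) (au av t Ru Rv : ℝ)
    (U : Fin nu → ℝ) (V : Fin nv → ℝ) (Z : Fin nu → Fin nv → ℝ)
    (Zt : Fin nu → ℝ) (Zb : Fin nv → ℝ)
    (u : Fin nu → ℝ) (v : Fin nv → ℝ) : ℝ :=
  (∑ i, ∑ j, ((1 - t) / (2 * n) * (u i) ^ 2 * (v j) ^ 2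
      - Real.sqrt ((1 - t) / n) * u i * v j
          * (Real.sqrt ((1 - t) / n) * U i * V j + Z i j)))
  + (∑ i, (av * Rv / 2 * (u i) ^ 2
      - Real.sqrt (av * Rv) * u i * (Real.sqrt (av * Rv) * U i + Zt i)))
  + (∑ j, (au * Ru / 2 * (v j) ^ 2
      - Real.sqrt (au * Ru) * v j * (Real.sqrt (au * Ru) * V j + Zb j)))

/-- The partition function `Z_{t,R} = ∫∫ e^{−H_{t,R}(u,v)} dP_u(u) dP_v(v)`. -/
def partFun (n nu nv : ℕ) (au av t Ru Rv : ℝ)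
    (Pu : Measure (Fin nu → ℝ)) (Pv : Measure (Fin nv → ℝ))
    (U : Fin nu → ℝ) (V : Fin nv → ℝ) (Z : Fin nu → Fin nv → ℝ)
    (Zt : Fin nu → ℝ) (Zb : Fin nv → ℝ) : ℝ :=
  ∫ u, (∫ v, Real.exp (-(interpH n nu nv au av t Ru Rv U V Z Zt Zb u v)) ∂Pv) ∂Pu

/-- The Gibbs bracket `⟨f⟩_{t,R}`, i.e. the expectation of `f(u,v)` under the
posterior measure proportional to `e^{−H_{t,R}(u,v)} dP_u(u) dP_v(v)`. -/
def gibbs (n nu nv : ℕ) (au av t Ru Rv : ℝ)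
    (Pu : Measure (Fin nu → ℝ)) (Pv : Measure (Fin nv → ℝ))
    (U : Fin nu → ℝ) (V : Fin nv → ℝ) (Z : Fin nu → Fin nv → ℝ)
    (Zt : Fin nu → ℝ) (Zb : Fin nv → ℝ)
    (f : (Fin nu → ℝ) → (Fin nv → ℝ) → ℝ) : ℝ :=
  (∫ u, (∫ v, f u v * Real.exp (-(interpH n nu nv au av t Ru Rv U V Z Zt Zb u v)) ∂Pv) ∂Pu)
    / partFun n nu nv au av t Ru Rv Pu Pv U V Z Zt Zb

/-- Expectation `E` over all the randomness `U ~ P_u`, `V ~ P_v` and the independent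
standard Gaussian noises `Z, Z̃, Z̄`. -/
def Efull (nu nv : ℕ)
    (Pu : Measure (Fin nu → ℝ)) (Pv : Measure (Fin nv → ℝ))
    (g : (Fin nu → ℝ) → (Fin nv → ℝ) → (Fin nu → Fin nv → ℝ) →
      (Fin nu → ℝ) → (Fin nv → ℝ) → ℝ) : ℝ :=
  ∫ U, (∫ V, (∫ Z, (∫ Zt, (∫ Zb, g U V Z Zt Zb
    ∂(stdGaussian nv)) ∂(stdGaussian nu)) ∂(stdGaussianMat nu nv)) ∂Pv) ∂Pu

/-- The average interpolating free entropy `fₙ(t,R) = (1/n) E ln Z_{t,R}`. -/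
def interpFreeEntropy (n nu nv : ℕ) (au av t Ru Rv : ℝ)
    (Pu : Measure (Fin nu → ℝ)) (Pv : Measure (Fin nv → ℝ)) : ℝ :=
  (1 / (n : ℝ)) * Efull nu nv Pu Pv (fun U V Z Zt Zb =>
    Real.log (partFun n nu nv au av t Ru Rv Pu Pv U V Z Zt Zb))

/-- The overlap `Q_u = (1/n_u) Σ_i u_i U_i`. -/
def overlapU (nu : ℕ) (u U : Fin nu → ℝ) : ℝ := (1 / (nu : ℝ)) * ∑ i, u i * U i

/-- The overlap `Q_v = (1/n_v) Σ_j v_j V_j`. -/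
def overlapV (nv : ℕ) (v V : Fin nv → ℝ) : ℝ := (1 / (nv : ℝ)) * ∑ j, v j * V j

/-- `E⟨Q_v⟩_{t,R}`. -/
def eQv (n nu nv : ℕ) (au av t Ru Rv : ℝ)
    (Pu : Measure (Fin nu → ℝ)) (Pv : Measure (Fin nv → ℝ)) : ℝ :=
  Efull nu nv Pu Pv (fun U V Z Zt Zb =>
    gibbs n nu nv au av t Ru Rv Pu Pv U V Z Zt Zb (fun _ v => overlapV nv v V))

/-- `E⟨Q_u⟩_{t,R}`. -/
def eQu (n nu nv : ℕ) (au av t Ru Rv : ℝ)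
    (Pu : Measure (Fin nu → ℝ)) (Pv : Measure (Fin nv → ℝ)) : ℝ :=
  Efull nu nv Pu Pv (fun U V Z Zt Zb =>
    gibbs n nu nv au av t Ru Rv Pu Pv U V Z Zt Zb (fun u _ => overlapU nu u U))

/-- The quantity `𝓛 = (1/n) Σ_j [(α_u/2)v_j² − α_u v_j V_j − (1/2)√(α_u/R_u) v_j Z̄_j]`. -/
def calL (n nv : ℕ) (au Ru : ℝ) (v V Zb : Fin nv → ℝ) : ℝ :=
  (1 / (n : ℝ)) * ∑ j, (au / 2 * (v j) ^ 2 - au * v j * V j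
    - 1 / 2 * Real.sqrt (au / Ru) * v j * Zb j)

/-- `E⟨𝓛⟩_{t,R}`. -/
def eL (n nu nv : ℕ) (au av t Ru Rv : ℝ)
    (Pu : Measure (Fin nu → ℝ)) (Pv : Measure (Fin nv → ℝ)) : ℝ :=
  Efull nu nv Pu Pv (fun U V Z Zt Zb =>
    gibbs n nu nv au av t Ru Rv Pu Pv U V Z Zt Zb (fun _ v => calL n nv au Ru v V Zb))

/-- `φ₀(m) = (m − ln(1+m))/2`. -/
def phi0 (m : ℝ) : ℝ := (m - Real.log (1 + m)) / 2


/-- The (random) free entropy `Fₙ(t,R) = (1/n) ln Z_{t,R}`. -/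
def randFreeEntropy (n nu nv : ℕ) (au av t Ru Rv : ℝ)
    (Pu : Measure (Fin nu → ℝ)) (Pv : Measure (Fin nv → ℝ))
    (U : Fin nu → ℝ) (V : Fin nv → ℝ) (Z : Fin nu → Fin nv → ℝ)
    (Zt : Fin nu → ℝ) (Zb : Fin nv → ℝ) : ℝ :=
  (1 / (n : ℝ)) * Real.log (partFun n nu nv au av t Ru Rv Pu Pv U V Z Zt Zb)

section GaussianVariance

variable {S : Type*} [TopologicalSpace S] [MeasurableSpace S]
  [BorelSpace S] {ν : Measure S} [IsProbabilityMeasure ν] {T : Set S}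
  {E : Type*} [NormedAddCommGroup E] [NormedSpace ℝ E]

/-- The log-partition function `x ↦ log ∫ exp (c s + ℓ s x) dν(s)`. -/
def logPartition (ν : Measure S) (c : S → ℝ) (ℓ : S → StrongDual ℝ E) (x : E) : ℝ :=
  log (∫ s, exp (c s + ℓ s x) ∂ν)

/-- The average of `s ↦ ℓ s y` under the Gibbs measure with density proportional to
`exp (c s + ℓ s x)`. -/
def gibbsAverage (ν : Measure S) (c : S → ℝ) (ℓ : S → StrongDual ℝ E) (x y : E) : ℝ :=
  (∫ s, ℓ s y * exp (c s + ℓ s x) ∂ν) / ∫ s, exp (c s + ℓ s x) ∂ν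

lemma integrable_of_continuous_of_ae_mem_compact (hT : IsCompact T) (hνT : ∀ᵐ s ∂ν, s ∈ T)
    {h : S → ℝ} (hh : Continuous h) : Integrable h ν := by
  obtain ⟨C, hC⟩ := hT.exists_bound_of_continuousOn hh.continuousOn
  exact Integrable.of_bound hh.measurable.aestronglyMeasurable C (hνT.mono hC)

lemma continuous_integral_of_ae_mem_compact {X : Type*} [TopologicalSpace X]
    [FirstCountableTopology X] [LocallyCompactSpace X] (hT : IsCompact T)
    (hνT : ∀ᵐ s ∂ν, s ∈ T) {h : X → S → ℝ} (hh : Continuous h.uncurry) :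
    Continuous fun x => ∫ s, h x s ∂ν := by
  rw [← Measure.restrict_eq_self_of_ae_mem hνT]
  exact continuous_parametric_integral_of_continuous hh hT

lemma sq_integral_mul_le {α : Type*} [MeasurableSpace α] {μ : Measure α} {h w : α → ℝ}
    (hw : ∀ s, 0 ≤ w s) (h0 : Integrable w μ)
    (h1 : Integrable (fun s => h s * w s) μ) (h2 : Integrable (fun s => h s ^ 2 * w s) μ) :
    (∫ s, h s * w s ∂μ) ^ 2 ≤ (∫ s, w s ∂μ) * ∫ s, h s ^ 2 * w s ∂μ := by
  have key : ∀ a : ℝ, 0 ≤ (∫ s, w s ∂μ) * (a * a) + (-2 * ∫ s, h s * w s ∂μ) * a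
      + ∫ s, h s ^ 2 * w s ∂μ := by
    intro a
    have e : (∫ s, w s ∂μ) * (a * a) + (-2 * ∫ s, h s * w s ∂μ) * a + ∫ s, h s ^ 2 * w s ∂μ
        = ∫ s, (h s - a) ^ 2 * w s ∂μ := by
      rw [show (fun s => (h s - a) ^ 2 * w s)
        = fun s => (a * a) * w s + (-2 * a) * (h s * w s) + h s ^ 2 * w s by ext; ring]
      rw [integral_add (f := fun s => (a * a) * w s + (-2 * a) * (h s * w s))
          ((h0.const_mul _).add (h1.const_mul _)) h2,
        integral_add (h0.const_mul _) (h1.const_mul _), integral_const_mul, integral_const_mul]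
      ring
    rw [e]
    exact integral_nonneg fun s => mul_nonneg (sq_nonneg _) (hw s)
  have := discrim_le_zero key
  rw [discrim] at this
  linarith

lemma integral_sq_sub_integral_le {α : Type*} [MeasurableSpace α] {μ : Measure α}
    [IsProbabilityMeasure μ] {f : α → ℝ} (hf : MemLp f 2 μ) (a : ℝ) :
    ∫ x, (f x - ∫ y, f y ∂μ) ^ 2 ∂μ ≤ ∫ x, (f x - a) ^ 2 ∂μ := by
  have hfa : MemLp (fun x => f x - a) 2 μ := hf.sub (memLp_const a)
  have h1 := ProbabilityTheory.variance_sub_const hf.aestronglyMeasurable a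
  have h2 := ProbabilityTheory.variance_le_expectation_sq hfa.aestronglyMeasurable
  rw [h1, ProbabilityTheory.variance_eq_integral hf.aestronglyMeasurable.aemeasurable] at h2
  exact h2

variable {c : S → ℝ} {ℓ : S → StrongDual ℝ E}

lemma continuous_partition [LocallyCompactSpace E] (hT : IsCompact T)
    (hνT : ∀ᵐ s ∂ν, s ∈ T) (hc : Continuous c) (hℓ : Continuous ℓ) :
    Continuous fun x : E => ∫ s, exp (c s + ℓ s x) ∂ν :=
  continuous_integral_of_ae_mem_compact hT hνT
    (h := fun (x : E) s => exp (c s + ℓ s x)) (by fun_prop)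

lemma partition_pos (hT : IsCompact T) (hνT : ∀ᵐ s ∂ν, s ∈ T)
    (hc : Continuous c) (hℓ : Continuous ℓ) (x : E) :
    0 < ∫ s, exp (c s + ℓ s x) ∂ν :=
  integral_exp_pos (integrable_of_continuous_of_ae_mem_compact hT hνT (by fun_prop))

lemma exists_norm_logPartition_le (hT : IsCompact T) (hνT : ∀ᵐ s ∂ν, s ∈ T)
    (hc : Continuous c) (hℓ : Continuous ℓ) :
    ∃ B K : ℝ, ∀ x : E, |logPartition ν c ℓ x| ≤ B + K * ‖x‖ := by
  obtain ⟨B, hB⟩ := hT.exists_bound_of_continuousOn hc.continuousOn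
  obtain ⟨K, hK⟩ := hT.exists_bound_of_continuousOn hℓ.continuousOn
  refine ⟨B, K, fun x => ?_⟩
  have hb : ∀ s ∈ T, |c s + ℓ s x| ≤ B + K * ‖x‖ := fun s hs =>
    (abs_add_le _ _).trans (add_le_add (hB s hs) ((ℓ s).le_of_opNorm_le (hK s hs) x))
  have hint : Integrable (fun s => exp (c s + ℓ s x)) ν :=
    integrable_of_continuous_of_ae_mem_compact hT hνT (by fun_prop)
  have hpos := partition_pos hT hνT hc hℓ x
  have hup : ∫ s, exp (c s + ℓ s x) ∂ν ≤ exp (B + K * ‖x‖) := by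
    simpa using integral_mono_ae hint (integrable_const (exp (B + K * ‖x‖)))
      (hνT.mono fun s hs => exp_le_exp.2 (abs_le.1 (hb s hs)).2)
  have hlow : exp (-(B + K * ‖x‖)) ≤ ∫ s, exp (c s + ℓ s x) ∂ν := by
    simpa using integral_mono_ae (integrable_const (exp (-(B + K * ‖x‖)))) hint
      (hνT.mono fun s hs => exp_le_exp.2 (abs_le.1 (hb s hs)).1)
  exact abs_le.2 ⟨(le_log_iff_exp_le hpos).2 hlow, (log_le_iff_le_exp hpos).2 hup⟩

lemma continuous_logPartition [LocallyCompactSpace E] (hT : IsCompact T)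
    (hνT : ∀ᵐ s ∂ν, s ∈ T) (hc : Continuous c) (hℓ : Continuous ℓ) :
    Continuous (logPartition ν c ℓ) :=
  (continuous_partition hT hνT hc hℓ).log fun x => (partition_pos hT hνT hc hℓ x).ne'

lemma continuous_gibbsAverage [LocallyCompactSpace E] (hT : IsCompact T)
    (hνT : ∀ᵐ s ∂ν, s ∈ T) (hc : Continuous c) (hℓ : Continuous ℓ) :
    Continuous fun p : E × E => gibbsAverage ν c ℓ p.1 p.2 := by
  refine Continuous.div ?_ ?_ fun p => (partition_pos hT hνT hc hℓ p.1).ne'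
  · exact continuous_integral_of_ae_mem_compact hT hνT
      (h := fun (p : E × E) s => ℓ s p.2 * exp (c s + ℓ s p.1)) (by fun_prop)
  · exact (continuous_partition hT hνT hc hℓ).comp continuous_fst

lemma sq_gibbsAverage_le (hT : IsCompact T) (hνT : ∀ᵐ s ∂ν, s ∈ T)
    (hc : Continuous c) (hℓ : Continuous ℓ) (x y : E) :
    gibbsAverage ν c ℓ x y ^ 2
      ≤ (∫ s, (ℓ s y) ^ 2 * exp (c s + ℓ s x) ∂ν) / ∫ s, exp (c s + ℓ s x) ∂ν := by
  have hpos := partition_pos hT hνT hc hℓ x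
  have key := sq_integral_mul_le (μ := ν) (h := fun s => ℓ s y)
    (w := fun s => exp (c s + ℓ s x)) (fun s => (exp_pos _).le)
    (integrable_of_continuous_of_ae_mem_compact hT hνT (by fun_prop))
    (integrable_of_continuous_of_ae_mem_compact hT hνT (by fun_prop))
    (integrable_of_continuous_of_ae_mem_compact hT hνT (by fun_prop))
  rw [gibbsAverage, div_pow, div_le_div_iff₀ (by positivity) hpos]
  nlinarith

lemma exists_sq_gibbsAverage_le (hT : IsCompact T) (hνT : ∀ᵐ s ∂ν, s ∈ T)
    (hc : Continuous c) (hℓ : Continuous ℓ) :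
    ∃ K : ℝ, 0 ≤ K ∧ ∀ x y : E, gibbsAverage ν c ℓ x y ^ 2 ≤ K * ‖y‖ ^ 2 := by
  obtain ⟨K, hK⟩ := hT.exists_bound_of_continuousOn hℓ.continuousOn
  refine ⟨K ^ 2, sq_nonneg K, fun x y => (sq_gibbsAverage_le hT hνT hc hℓ x y).trans ?_⟩
  rw [div_le_iff₀ (partition_pos hT hνT hc hℓ x), ← integral_const_mul]
  refine integral_mono_ae
    (integrable_of_continuous_of_ae_mem_compact hT hνT (by fun_prop))
    (integrable_of_continuous_of_ae_mem_compact hT hνT (by fun_prop))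
    (hνT.mono fun s hs => mul_le_mul_of_nonneg_right ?_ (exp_pos _).le)
  rw [← mul_pow]
  exact sq_le_sq' (neg_le_of_abs_le ((ℓ s).le_of_opNorm_le (hK s hs) y))
    (le_of_abs_le ((ℓ s).le_of_opNorm_le (hK s hs) y))

lemma hasDerivAt_logPartition_rotation (hT : IsCompact T) (hνT : ∀ᵐ s ∂ν, s ∈ T)
    (hc : Continuous c) (hℓ : Continuous ℓ) (x y : E) (θ : ℝ) :
    HasDerivAt (fun θ : ℝ => logPartition ν c ℓ (cos θ • x + sin θ • y))
      (gibbsAverage ν c ℓ (cos θ • x + sin θ • y) (-sin θ • x + cos θ • y)) θ := by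
  refine HasDerivAt.log ?_ (partition_pos hT hνT hc hℓ _).ne'
  obtain ⟨C, hC⟩ := (hT.prod (isCompact_closedBall θ 1)).exists_bound_of_continuousOn
    (f := fun p : S × ℝ => ℓ p.1 (-sin p.2 • x + cos p.2 • y)
      * exp (c p.1 + ℓ p.1 (cos p.2 • x + sin p.2 • y))) (by fun_prop)
  refine (hasDerivAt_integral_of_dominated_loc_of_deriv_le (μ := ν)
    (F := fun θ s => exp (c s + ℓ s (cos θ • x + sin θ • y)))
    (F' := fun θ s => ℓ s (-sin θ • x + cos θ • y) * exp (c s + ℓ s (cos θ • x + sin θ • y)))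
    (bound := fun _ => C) (Metric.closedBall_mem_nhds θ one_pos) ?_ ?_ ?_ ?_ ?_ ?_).2
  · exact Eventually.of_forall fun θ =>
      (integrable_of_continuous_of_ae_mem_compact hT hνT (by fun_prop)).aestronglyMeasurable
  · exact integrable_of_continuous_of_ae_mem_compact hT hνT (by fun_prop)
  · exact (integrable_of_continuous_of_ae_mem_compact hT hνT (by fun_prop)).aestronglyMeasurable
  · exact hνT.mono fun s hs θ' hθ' => hC (s, θ') ⟨hs, hθ'⟩
  · exact integrable_const C
  · refine Eventually.of_forall fun s θ' _ => ?_
    have h1 : HasDerivAt (fun θ : ℝ => cos θ • x + sin θ • y)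
        (-sin θ' • x + cos θ' • y) θ' :=
      ((hasDerivAt_cos θ').smul_const x).add ((hasDerivAt_sin θ').smul_const y)
    have h2 := (((ℓ s).hasFDerivAt.comp_hasDerivAt θ' h1).const_add (c s)).exp
    rw [mul_comm]
    exact h2

lemma sq_logPartition_sub_le (hT : IsCompact T) (hνT : ∀ᵐ s ∂ν, s ∈ T)
    (hc : Continuous c) (hℓ : Continuous ℓ) [LocallyCompactSpace E] (x y : E) :
    (logPartition ν c ℓ y - logPartition ν c ℓ x) ^ 2
      ≤ π / 2 * ∫ θ in Ioc 0 (π / 2), gibbsAverage ν c ℓ (cos θ • x + sin θ • y)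
          (-sin θ • x + cos θ • y) ^ 2 := by
  have hcont : Continuous fun θ : ℝ => gibbsAverage ν c ℓ (cos θ • x + sin θ • y)
      (-sin θ • x + cos θ • y) :=
    (continuous_gibbsAverage hT hνT hc hℓ).comp
      (f := fun θ : ℝ => (cos θ • x + sin θ • y, -sin θ • x + cos θ • y)) (by fun_prop)
  have hftc := intervalIntegral.integral_eq_sub_of_hasDerivAt (a := 0) (b := π / 2)
    (fun θ _ => hasDerivAt_logPartition_rotation hT hνT hc hℓ x y θ)
    (hcont.intervalIntegrable _ _)
  simp only [cos_pi_div_two, sin_pi_div_two, cos_zero, sin_zero, zero_smul, one_smul, zero_add,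
    add_zero] at hftc
  rw [← hftc, intervalIntegral.integral_of_le (by positivity)]
  have hI : ∀ g : ℝ → ℝ, Continuous g → Integrable g (volume.restrict (Ioc 0 (π / 2))) :=
    fun g hg => (hg.integrableOn_Icc).mono_set Ioc_subset_Icc_self
  have := sq_integral_mul_le (μ := volume.restrict (Ioc 0 (π / 2)))
    (h := fun θ : ℝ => gibbsAverage ν c ℓ (cos θ • x + sin θ • y) (-sin θ • x + cos θ • y))
    (w := fun _ => 1) (fun _ => zero_le_one) (hI _ (by fun_prop)) (hI _ (by fun_prop))
    (hI _ (by fun_prop))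
  simpa [max_eq_left pi_div_two_pos.le] using this

variable [MeasurableSpace E] [BorelSpace E] [SecondCountableTopology E] [CompleteSpace E]
  [LocallyCompactSpace E] {γ : Measure E} [ProbabilityTheory.IsGaussian γ]

lemma memLp_logPartition (hT : IsCompact T) (hνT : ∀ᵐ s ∂ν, s ∈ T)
    (hc : Continuous c) (hℓ : Continuous ℓ) : MemLp (logPartition ν c ℓ) 2 γ := by
  obtain ⟨B, K, hBK⟩ := exists_norm_logPartition_le hT hνT hc hℓ
  have hB : MemLp (fun x : E => B + K * ‖x‖) 2 γ :=
    (memLp_const B).add (ProbabilityTheory.IsGaussian.memLp_two_id.norm.const_mul K)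
  exact hB.of_le (continuous_logPartition hT hνT hc hℓ).aestronglyMeasurable
    (Eventually.of_forall fun x => (hBK x).trans (le_abs_self _))

lemma integrable_sq_norm_snd :
    Integrable (fun p : E × E => ‖p.2‖ ^ 2) (γ.prod γ) :=
  (ProbabilityTheory.IsGaussian.memLp_two_id (μ := γ)).norm.integrable_sq.comp_snd γ

lemma integrable_sq_gibbsAverage (hT : IsCompact T) (hνT : ∀ᵐ s ∂ν, s ∈ T)
    (hc : Continuous c) (hℓ : Continuous ℓ) :
    Integrable (fun p : E × E => gibbsAverage ν c ℓ p.1 p.2 ^ 2) (γ.prod γ) := by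
  obtain ⟨K, -, hK⟩ := exists_sq_gibbsAverage_le hT hνT hc hℓ
  refine ((integrable_sq_norm_snd (γ := γ)).const_mul K).mono'
    ((continuous_gibbsAverage hT hνT hc hℓ).pow 2).aestronglyMeasurable
    (Eventually.of_forall fun p => ?_)
  rw [norm_of_nonneg (sq_nonneg _)]
  exact hK _ _

lemma integral_sq_gibbsAverage_le (hT : IsCompact T) (hνT : ∀ᵐ s ∂ν, s ∈ T)
    (hc : Continuous c) (hℓ : Continuous ℓ) {V : ℝ}
    (hV : ∀ s ∈ T, ∫ y, (ℓ s y) ^ 2 ∂γ ≤ V) (x : E) :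
    ∫ y, gibbsAverage ν c ℓ x y ^ 2 ∂γ ≤ V := by
  have hpos := partition_pos hT hνT hc hℓ x
  obtain ⟨C, hC⟩ := hT.exists_bound_of_continuousOn
    (f := fun s => ‖ℓ s‖ ^ 2 * exp (c s + ℓ s x)) (by fun_prop)
  have hint : Integrable (fun p : S × E => (ℓ p.1 p.2) ^ 2 * exp (c p.1 + ℓ p.1 x))
      (ν.prod γ) := by
    have hsq : Integrable (fun p : S × E => C * ‖p.2‖ ^ 2) (ν.prod γ) :=
      ((ProbabilityTheory.IsGaussian.memLp_two_id (μ := γ)).norm.integrable_sq.comp_snd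
        ν).const_mul C
    refine hsq.mono' (Continuous.aestronglyMeasurable (by fun_prop)) ?_
    filter_upwards [Measure.quasiMeasurePreserving_fst.ae hνT] with p hp
    have hCp := (le_abs_self _).trans (hC p.1 hp)
    have hop : (ℓ p.1 p.2) ^ 2 ≤ (‖ℓ p.1‖ * ‖p.2‖) ^ 2 :=
      sq_le_sq' (neg_le_of_abs_le ((ℓ p.1).le_opNorm p.2)) (le_of_abs_le ((ℓ p.1).le_opNorm p.2))
    rw [norm_of_nonneg (by positivity)]
    calc (ℓ p.1 p.2) ^ 2 * exp (c p.1 + ℓ p.1 x)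
        ≤ (‖ℓ p.1‖ * ‖p.2‖) ^ 2 * exp (c p.1 + ℓ p.1 x) := by gcongr
      _ = ‖ℓ p.1‖ ^ 2 * exp (c p.1 + ℓ p.1 x) * ‖p.2‖ ^ 2 := by ring
      _ ≤ C * ‖p.2‖ ^ 2 := by gcongr
  calc ∫ y, gibbsAverage ν c ℓ x y ^ 2 ∂γ
      ≤ ∫ y, (∫ s, (ℓ s y) ^ 2 * exp (c s + ℓ s x) ∂ν) / (∫ s, exp (c s + ℓ s x) ∂ν) ∂γ :=
        integral_mono_of_nonneg (Eventually.of_forall fun y => sq_nonneg _)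
          (hint.integral_prod_right.div_const _)
          (Eventually.of_forall fun y => sq_gibbsAverage_le hT hνT hc hℓ x y)
    _ = (∫ s, (∫ y, (ℓ s y) ^ 2 ∂γ) * exp (c s + ℓ s x) ∂ν) / ∫ s, exp (c s + ℓ s x) ∂ν := by
        rw [integral_div, ← integral_integral_swap hint]
        simp_rw [integral_mul_const]
    _ ≤ V := by
        rw [div_le_iff₀ hpos, ← integral_const_mul]
        refine integral_mono_ae ?_
          (integrable_of_continuous_of_ae_mem_compact hT hνT (by fun_prop))
          (hνT.mono fun s hs => mul_le_mul_of_nonneg_right (hV s hs) (exp_pos _).le)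
        simpa only [integral_mul_const] using hint.integral_prod_left

/-- Poincaré-type inequality: the log-partition function of a centered Gaussian field has variance
at most a constant times the maximal variance of the field. -/
lemma variance_logPartition_le (hγ : ∀ L : StrongDual ℝ E, ∫ x, L x ∂γ = 0)
    (hT : IsCompact T) (hνT : ∀ᵐ s ∂ν, s ∈ T) (hc : Continuous c) (hℓ : Continuous ℓ) {V : ℝ}
    (hV : ∀ s ∈ T, ∫ y, (ℓ s y) ^ 2 ∂γ ≤ V) :
    ∫ x, (logPartition ν c ℓ x - ∫ y, logPartition ν c ℓ y ∂γ) ^ 2 ∂γ ≤ (π / 2) ^ 2 * V := by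
  set f := logPartition ν c ℓ
  set D : E × E → ℝ := fun p => gibbsAverage ν c ℓ p.1 p.2 ^ 2
  set R : ℝ → E × E → E × E := fun θ p => ContinuousLinearMap.rotation θ p
  have hf : MemLp f 2 γ := memLp_logPartition hT hνT hc hℓ
  have hD : Integrable D (γ.prod γ) := integrable_sq_gibbsAverage hT hνT hc hℓ
  have hDc : Continuous D := (continuous_gibbsAverage hT hνT hc hℓ).pow 2
  have hRc : Continuous fun q : ℝ × (E × E) => R q.1 q.2 := by
    simp only [R, ContinuousLinearMap.rotation_apply]
    fun_prop
  have hmap : ∀ θ, (γ.prod γ).map (R θ) = γ.prod γ :=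
    ProbabilityTheory.IsGaussian.map_rotation_eq_self_of_forall_strongDual_eq_zero hγ
  have hDR : Integrable (fun q : ℝ × (E × E) => D (R q.1 q.2))
      ((volume.restrict (Ioc 0 (π / 2))).prod (γ.prod γ)) := by
    obtain ⟨K, hK0, hK⟩ := exists_sq_gibbsAverage_le (E := E) hT hνT hc hℓ
    have hsq := (ProbabilityTheory.IsGaussian.memLp_two_id (μ := γ)).norm.integrable_sq
    refine (((hsq.comp_fst γ).add (hsq.comp_snd γ)).const_mul (2 * K)).comp_snd
      (volume.restrict (Ioc 0 (π / 2))) |>.mono' (hDc.comp hRc).aestronglyMeasurable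
      (Eventually.of_forall fun q => ?_)
    obtain ⟨θ, x, y⟩ := q
    have hn : ‖-sin θ • x + cos θ • y‖ ≤ ‖x‖ + ‖y‖ := by
      refine (norm_add_le _ _).trans (add_le_add ?_ ?_) <;> rw [norm_smul]
      · exact mul_le_of_le_one_left (norm_nonneg _) (by simpa using abs_sin_le_one θ)
      · exact mul_le_of_le_one_left (norm_nonneg _) (abs_cos_le_one θ)
    rw [norm_of_nonneg (sq_nonneg _)]
    refine (hK _ _).trans ?_
    simp only [R, ContinuousLinearMap.rotation_apply, Pi.add_apply, id_eq]
    calc K * ‖-sin θ • x + cos θ • y‖ ^ 2 ≤ K * (‖x‖ + ‖y‖) ^ 2 := by gcongr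
      _ ≤ K * (2 * (‖x‖ ^ 2 + ‖y‖ ^ 2)) := by gcongr; exact add_sq_le
      _ = 2 * K * (‖x‖ ^ 2 + ‖y‖ ^ 2) := by ring
  have hdiff : ∫ p, (f p.2 - f p.1) ^ 2 ∂(γ.prod γ) ≤ (π / 2) ^ 2 * V := by
    calc ∫ p, (f p.2 - f p.1) ^ 2 ∂(γ.prod γ)
        ≤ ∫ p, π / 2 * (∫ θ in Ioc 0 (π / 2), D (R θ p)) ∂(γ.prod γ) :=
          integral_mono_of_nonneg (Eventually.of_forall fun p => sq_nonneg _)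
            (hDR.integral_prod_right.const_mul _)
            (Eventually.of_forall fun p => sq_logPartition_sub_le hT hνT hc hℓ p.1 p.2)
      _ = π / 2 * ∫ θ in Ioc 0 (π / 2), (∫ p, D p ∂(γ.prod γ)) := by
          rw [integral_const_mul, ← integral_integral_swap hDR]
          congr 2 with θ
          conv_rhs => rw [← hmap θ]
          rw [integral_map (by fun_prop) hDc.aestronglyMeasurable]
      _ = (π / 2) ^ 2 * ∫ p, D p ∂(γ.prod γ) := by
          simp [max_eq_left pi_div_two_pos.le]; ring
      _ ≤ (π / 2) ^ 2 * V := by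
          refine mul_le_mul_of_nonneg_left ?_ (sq_nonneg _)
          rw [integral_prod _ hD]
          simpa using integral_mono hD.integral_prod_left (integrable_const V)
            fun x => integral_sq_gibbsAverage_le hT hνT hc hℓ hV x
  refine le_trans ?_ hdiff
  rw [integral_prod (fun p : E × E => (f p.2 - f p.1) ^ 2)
    ((hf.comp_snd γ).sub (hf.comp_fst γ)).integrable_sq]
  simpa using integral_mono (integrable_const (∫ x, (f x - ∫ y, f y ∂γ) ^ 2 ∂γ))
    ((hf.comp_snd γ).sub (hf.comp_fst γ)).integrable_sq.integral_prod_left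
    fun x => integral_sq_sub_integral_le hf (f x)

end GaussianVariance

section GaussianProduct

variable {ι G H : Type*} [Fintype ι] [NormedAddCommGroup G] [NormedSpace ℝ G]
  [MeasurableSpace G] [BorelSpace G] [SecondCountableTopology G] [CompleteSpace G]
  [NormedAddCommGroup H] [NormedSpace ℝ H]
  [MeasurableSpace H] [BorelSpace H] [SecondCountableTopology H] [CompleteSpace H]
  {μ : Measure G} [ProbabilityTheory.IsGaussian μ] {η : Measure H} [ProbabilityTheory.IsGaussian η]

instance isGaussian_pi : ProbabilityTheory.IsGaussian (Measure.pi fun _ : ι => μ) := by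
  have h := ProbabilityTheory.iIndepFun.hasGaussianLaw (X := fun i (ω : ι → G) => ω i)
    (P := Measure.pi fun _ : ι => μ)
    (fun i => ⟨by rw [(measurePreserving_eval (fun _ : ι => μ) i).map_eq]; infer_instance⟩)
    (ProbabilityTheory.iIndepFun_pi (X := fun _ : ι => (id : G → G)) fun i => aemeasurable_id)
  simpa using h.isGaussian_map

omit [SecondCountableTopology G] [CompleteSpace G] in
lemma integral_dual_pi_eq_zero (hμ : ∀ L : StrongDual ℝ G, ∫ x, L x ∂μ = 0)
    (L : StrongDual ℝ (ι → G)) : ∫ x, L x ∂(Measure.pi fun _ : ι => μ) = 0 := by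
  classical
  have hL : ∀ x, L x = ∑ i, L.comp (.single ℝ (fun _ => G) i) (x i) :=
    fun x => (ContinuousLinearMap.sum_comp_single ℝ (fun _ => G) L x).symm
  simp_rw [hL]
  have hint : ∀ L' : StrongDual ℝ G, Integrable L' μ :=
    ProbabilityTheory.IsGaussian.integrable_dual μ
  rw [integral_finsetSum _ fun i _ => integrable_comp_eval (μ := fun _ : ι => μ) (hint _)]
  refine Finset.sum_eq_zero fun i _ => ?_
  rw [integral_comp_eval (μ := fun _ : ι => μ) (hint _).aestronglyMeasurable]
  exact hμ _

omit [CompleteSpace G] [CompleteSpace H] in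
lemma integral_dual_prod_eq_zero (hμ : ∀ L : StrongDual ℝ G, ∫ x, L x ∂μ = 0)
    (hη : ∀ L : StrongDual ℝ H, ∫ x, L x ∂η = 0) (L : StrongDual ℝ (G × H)) :
    ∫ x, L x ∂(μ.prod η) = 0 := by
  simp_rw [← L.comp_inl_add_comp_inr]
  have h1 := ProbabilityTheory.IsGaussian.integrable_dual μ (L.comp (.inl ℝ G H))
  have h2 := ProbabilityTheory.IsGaussian.integrable_dual η (L.comp (.inr ℝ G H))
  rw [integral_add (h1.comp_fst η) (h2.comp_snd μ), integral_fun_fst, integral_fun_snd, hμ, hη]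
  simp

/-- A product of identical centered Gaussian measures is invariant under orthogonal mixing of the
coordinates. -/
lemma map_orthogonal_pi [DecidableEq ι] (hμ : ∀ L : StrongDual ℝ G, ∫ x, L x ∂μ = 0)
    {O : Matrix ι ι ℝ} (hO : O ∈ Matrix.orthogonalGroup ι ℝ) :
    (Measure.pi fun _ : ι => μ).map (fun x i => ∑ k, O i k • x k) = Measure.pi fun _ : ι => μ := by
  let T : (ι → G) →L[ℝ] (ι → G) :=
    ContinuousLinearMap.pi fun i => ∑ k, O i k • ContinuousLinearMap.proj k
  have hT : (fun (x : ι → G) i => ∑ k, O i k • x k) = T := by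
    ext x i; simp [T]
  rw [hT]
  refine Measure.ext_of_charFunDual (funext fun L => ?_)
  have hL : ∀ k, (L.comp T).comp (.single ℝ (fun _ => G) k)
      = ∑ i, O i k • L.comp (.single ℝ (fun _ => G) i) := by
    intro k
    ext x
    have : T (Pi.single k x) = ∑ i, O i k • Pi.single i x := by
      ext i
      simp [T, Pi.single_apply, Finset.sum_apply]
    simp [this]
  rw [charFunDual_map]
  rw [charFunDual_pi, charFunDual_pi]
  simp_rw [ProbabilityTheory.IsGaussian.charFunDual_eq_of_forall_strongDual_eq_zero hμ,
    ← Complex.exp_sum]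
  congr 1
  rw [← Finset.sum_div, ← Finset.sum_div, Finset.sum_neg_distrib, Finset.sum_neg_distrib]
  congr 2
  norm_cast
  have hcov : ∀ k, ProbabilityTheory.variance ((L.comp T).comp (.single ℝ (fun _ => G) k)) μ
      = ∑ i, ∑ j, O i k * O j k * ProbabilityTheory.covariance
        (L.comp (.single ℝ (fun _ => G) i)) (L.comp (.single ℝ (fun _ => G) j)) μ := by
    intro k
    have hm : ∀ i, MemLp (fun x => O i k * L.comp (.single ℝ (fun _ => G) i) x) 2 μ := fun i =>
      (ProbabilityTheory.IsGaussian.memLp_dual μ _ 2 (by simp)).const_mul _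
    have hs : ⇑(L.comp T ∘SL .single ℝ (fun _ => G) k)
        = fun x => ∑ i, O i k * L.comp (.single ℝ (fun _ => G) i) x := by
      rw [hL]
      ext x
      simp
    rw [hs, ProbabilityTheory.variance_fun_sum hm]
    simp_rw [ProbabilityTheory.covariance_const_mul_left,
      ProbabilityTheory.covariance_const_mul_right, mul_assoc]
  simp_rw [hcov]
  rw [Finset.sum_comm]
  refine Finset.sum_congr rfl fun i _ => ?_
  rw [Finset.sum_comm]
  simp_rw [← Finset.sum_mul]
  have hOO : ∀ j, ∑ k, O i k * O j k = if i = j then 1 else 0 := fun j => by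
    have := congrFun (congrFun ((Matrix.mem_orthogonalGroup_iff ι ℝ).1 hO) i) j
    simpa [Matrix.mul_apply, Matrix.one_apply, Matrix.star_apply] using this
  simp_rw [hOO]
  simp only [ite_mul, one_mul, zero_mul, Finset.sum_ite_eq, Finset.mem_univ, if_true]
  exact ProbabilityTheory.covariance_self (ContinuousLinearMap.measurable _).aemeasurable

end GaussianProduct

lemma sum_sq_le {a b c : ℝ} : (a + b + c) ^ 2 ≤ 3 * (a ^ 2 + b ^ 2 + c ^ 2) := by
  nlinarith [sq_nonneg (a - b), sq_nonneg (b - c), sq_nonneg (a - c)]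

instance isGaussian_stdGaussian (n : ℕ) : ProbabilityTheory.IsGaussian (stdGaussian n) := by
  unfold stdGaussian; infer_instance

instance isGaussian_stdGaussianMat (p q : ℕ) :
    ProbabilityTheory.IsGaussian (stdGaussianMat p q) := by
  unfold stdGaussianMat; infer_instance

lemma integral_dual_gaussianReal (L : StrongDual ℝ ℝ) :
    ∫ x, L x ∂(ProbabilityTheory.gaussianReal 0 1) = 0 := by
  simp

lemma integral_dual_stdGaussian (n : ℕ) (L : StrongDual ℝ (Fin n → ℝ)) :
    ∫ x, L x ∂(stdGaussian n) = 0 :=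
  integral_dual_pi_eq_zero integral_dual_gaussianReal L

lemma integral_dual_stdGaussianMat (p q : ℕ) (L : StrongDual ℝ (Fin p → Fin q → ℝ)) :
    ∫ x, L x ∂(stdGaussianMat p q) = 0 :=
  integral_dual_pi_eq_zero (integral_dual_stdGaussian q) L

lemma memLp_sum_mul_stdGaussian {n : ℕ} (b : Fin n → ℝ) :
    MemLp (fun x : Fin n → ℝ => ∑ i, b i * x i) 2 (stdGaussian n) := by
  have h := ProbabilityTheory.IsGaussian.memLp_dual (stdGaussian n)
    (∑ i, b i • ContinuousLinearMap.proj i) 2 (by simp)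
  convert h using 2 with x
  simp

lemma variance_sum_mul_stdGaussian {n : ℕ} (b : Fin n → ℝ) :
    ProbabilityTheory.variance (fun x : Fin n → ℝ => ∑ i, b i * x i) (stdGaussian n)
      = ∑ i, b i ^ 2 := by
  have h := ProbabilityTheory.variance_sum_pi
    (μ := fun _ : Fin n => ProbabilityTheory.gaussianReal 0 1) (X := fun i x => b i * x)
    (fun i => (ProbabilityTheory.IsGaussian.memLp_two_id
      (μ := ProbabilityTheory.gaussianReal 0 1)).const_mul (b i))
  have hb : ∀ i, ProbabilityTheory.variance (fun x => b i * x)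
      (ProbabilityTheory.gaussianReal 0 1) = b i ^ 2 := fun i => by
    rw [ProbabilityTheory.variance_const_mul, ProbabilityTheory.variance_fun_id_gaussianReal]
    simp
  simp_rw [← hb]
  rw [← h]
  congr 1
  ext; simp

lemma variance_sum_mul_stdGaussianMat {p q : ℕ} (a : Fin p → Fin q → ℝ) :
    ProbabilityTheory.variance (fun x : Fin p → Fin q → ℝ => ∑ i, ∑ j, a i j * x i j)
      (stdGaussianMat p q) = ∑ i, ∑ j, a i j ^ 2 := by
  have h := ProbabilityTheory.variance_sum_pi
    (μ := fun _ : Fin p => stdGaussian q) (X := fun i x => ∑ j, a i j * x j)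
    (fun i => memLp_sum_mul_stdGaussian (a i))
  simp_rw [variance_sum_mul_stdGaussian] at h
  rw [← h]
  congr 1
  ext; simp

section Sphere

/-- Two vectors with the same Euclidean norm are related by an orthogonal matrix. -/
lemma exists_orthogonal_mulVec_eq {m : ℕ} {x y : Fin m → ℝ} (h : x ⬝ᵥ x = y ⬝ᵥ y) :
    ∃ O ∈ Matrix.orthogonalGroup (Fin m) ℝ, O.mulVec x = y := by
  by_cases hxy : x = y
  · exact ⟨1, one_mem _, by simp [hxy]⟩
  have hw : (x - y) ⬝ᵥ (x - y) ≠ 0 := fun h0 =>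
    hxy (sub_eq_zero.1 (dotProduct_self_eq_zero.1 h0))
  have hwx : 2 * ((x - y) ⬝ᵥ x) = (x - y) ⬝ᵥ (x - y) := by
    simp only [sub_dotProduct, dotProduct_sub, h, dotProduct_comm y x]
    ring
  set w := x - y with hw_def
  refine ⟨1 - (2 / (w ⬝ᵥ w)) • Matrix.vecMulVec w w, ?_, ?_⟩
  · rw [Matrix.mem_orthogonalGroup_iff]
    have ht : (1 - (2 / (w ⬝ᵥ w)) • Matrix.vecMulVec w w).transpose
        = 1 - (2 / (w ⬝ᵥ w)) • Matrix.vecMulVec w w := by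
      ext i j
      simp [Matrix.vecMulVec_apply, Matrix.one_apply, eq_comm, mul_comm]
    rw [ht, sub_mul, mul_sub, mul_sub, one_mul, mul_one, one_mul, smul_mul_smul_comm,
      Matrix.vecMulVec_mul_vecMulVec]
    ext i j
    simp only [Matrix.sub_apply, Matrix.smul_apply, Matrix.vecMulVec_apply, smul_eq_mul,
      Pi.smul_apply]
    field_simp
    ring
  · rw [Matrix.sub_mulVec, Matrix.one_mulVec, Matrix.smul_mulVec, Matrix.vecMulVec_mulVec]
    ext i
    have : 2 / (w ⬝ᵥ w) * (w ⬝ᵥ x) = 1 := by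
      rw [div_mul_eq_mul_div, hwx, div_self hw]
    simp only [Pi.sub_apply, Pi.smul_apply, smul_eq_mul, MulOpposite.smul_eq_mul_unop,
      MulOpposite.unop_op]
    rw [mul_comm (w i), ← mul_assoc, this, hw_def]
    simp

lemma dotProduct_orthogonal_mulVec {m : ℕ} {O : Matrix (Fin m) (Fin m) ℝ}
    (hO : O ∈ Matrix.orthogonalGroup (Fin m) ℝ) (x y : Fin m → ℝ) :
    O.mulVec x ⬝ᵥ O.mulVec y = x ⬝ᵥ y := by
  have h := (Matrix.mem_orthogonalGroup_iff' (Fin m) ℝ).1 hO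
  rw [Matrix.dotProduct_mulVec, Matrix.vecMul_mulVec, h, Matrix.vecMul_one]

lemma isCompact_setOf_sum_sq_eq (m : ℕ) (r : ℝ) :
    IsCompact {x : Fin m → ℝ | ∑ i, x i ^ 2 = r ^ 2} := by
  refine Metric.isCompact_of_isClosed_isBounded
    (isClosed_eq (by fun_prop) continuous_const)
    (isBounded_iff_forall_norm_le.2 ⟨|r|, fun x hx => ?_⟩)
  refine (pi_norm_le_iff_of_nonneg (abs_nonneg r)).2 fun i => ?_
  rw [Real.norm_eq_abs, ← sq_le_sq, ← (show ∑ i, x i ^ 2 = r ^ 2 from hx)]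
  exact Finset.single_le_sum (f := fun i => x i ^ 2) (fun j _ => sq_nonneg _) (Finset.mem_univ i)

end Sphere

section Noise

/-- The joint law of the Gaussian noises `(Z, Z̃, Z̄)`. -/
abbrev noiseMeasure (p q : ℕ) :
    Measure ((Fin p → Fin q → ℝ) × (Fin p → ℝ) × (Fin q → ℝ)) :=
  (stdGaussianMat p q).prod ((stdGaussian p).prod (stdGaussian q))

lemma integral_dual_noiseMeasure (p q : ℕ)
    (L : StrongDual ℝ ((Fin p → Fin q → ℝ) × (Fin p → ℝ) × (Fin q → ℝ))) :
    ∫ x, L x ∂(noiseMeasure p q) = 0 :=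
  integral_dual_prod_eq_zero (integral_dual_stdGaussianMat p q)
    (integral_dual_prod_eq_zero (integral_dual_stdGaussian p) (integral_dual_stdGaussian q)) L

lemma integral_integral_integral_noise {p q : ℕ}
    {h : (Fin p → Fin q → ℝ) × (Fin p → ℝ) × (Fin q → ℝ) → ℝ}
    (hh : Integrable h (noiseMeasure p q)) :
    ∫ Z, (∫ Zt, (∫ Zb, h (Z, Zt, Zb) ∂(stdGaussian q)) ∂(stdGaussian p)) ∂(stdGaussianMat p q)
      = ∫ x, h x ∂(noiseMeasure p q) := by
  rw [noiseMeasure, integral_prod _ hh]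
  refine integral_congr_ae ?_
  filter_upwards [hh.prod_right_ae] with Z hZ
  rw [integral_prod _ hZ]

/-- The linear dependence of `-H_{t,R}(u,v)` on the noises, with coefficients `a`, `b`, `c` in
front of the three noise channels. -/
def noiseForm {p q : ℕ} (a b c : ℝ) (s : (Fin p → ℝ) × (Fin q → ℝ)) :
    StrongDual ℝ ((Fin p → Fin q → ℝ) × (Fin p → ℝ) × (Fin q → ℝ)) :=
  (∑ i, ∑ j, (a * s.1 i * s.2 j) • (ContinuousLinearMap.proj j).comp
      ((ContinuousLinearMap.proj i).comp (.fst ℝ (Fin p → Fin q → ℝ) ((Fin p → ℝ) × (Fin q → ℝ)))))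
    + (∑ i, (b * s.1 i) • (ContinuousLinearMap.proj i).comp ((ContinuousLinearMap.fst ℝ _ _).comp
      (.snd ℝ (Fin p → Fin q → ℝ) ((Fin p → ℝ) × (Fin q → ℝ)))))
    + ∑ j, (c * s.2 j) • (ContinuousLinearMap.proj j).comp ((ContinuousLinearMap.snd ℝ _ _).comp
      (.snd ℝ (Fin p → Fin q → ℝ) ((Fin p → ℝ) × (Fin q → ℝ))))

lemma noiseForm_apply {p q : ℕ} (a b c : ℝ) (s : (Fin p → ℝ) × (Fin q → ℝ))
    (x : (Fin p → Fin q → ℝ) × (Fin p → ℝ) × (Fin q → ℝ)) :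
    noiseForm a b c s x = (∑ i, ∑ j, a * s.1 i * s.2 j * x.1 i j)
      + (∑ i, b * s.1 i * x.2.1 i) + ∑ j, c * s.2 j * x.2.2 j := by
  simp [noiseForm]

lemma continuous_noiseForm {p q : ℕ} (a b c : ℝ) :
    Continuous (noiseForm (p := p) (q := q) a b c) := by
  unfold noiseForm
  fun_prop

lemma integral_sq_sum_mul_stdGaussian {n : ℕ} (b : Fin n → ℝ) :
    ∫ x, (∑ i, b i * x i) ^ 2 ∂(stdGaussian n) = ∑ i, b i ^ 2 := by
  rw [← variance_sum_mul_stdGaussian,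
    ProbabilityTheory.variance_of_integral_eq_zero (memLp_sum_mul_stdGaussian b).aemeasurable]
  simpa using integral_dual_stdGaussian n
    (∑ i, b i • ContinuousLinearMap.proj (R := ℝ) (φ := fun _ : Fin n => ℝ) i)

lemma exists_dual_eq_sum_mul {p q : ℕ} (a : Fin p → Fin q → ℝ) :
    ∃ L : StrongDual ℝ (Fin p → Fin q → ℝ), ∀ x, L x = ∑ i, ∑ j, a i j * x i j :=
  ⟨∑ i, ∑ j, a i j • (ContinuousLinearMap.proj (R := ℝ) (φ := fun _ : Fin q => ℝ) j).comp
    (ContinuousLinearMap.proj (R := ℝ) (φ := fun _ : Fin p => Fin q → ℝ) i), by simp⟩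

lemma memLp_sum_mul_stdGaussianMat {p q : ℕ} (a : Fin p → Fin q → ℝ) :
    MemLp (fun x : Fin p → Fin q → ℝ => ∑ i, ∑ j, a i j * x i j) 2 (stdGaussianMat p q) := by
  obtain ⟨L, hL⟩ := exists_dual_eq_sum_mul a
  simpa only [← hL] using ProbabilityTheory.IsGaussian.memLp_dual (stdGaussianMat p q) L 2 (by simp)

lemma integral_sq_sum_mul_stdGaussianMat {p q : ℕ} (a : Fin p → Fin q → ℝ) :
    ∫ x, (∑ i, ∑ j, a i j * x i j) ^ 2 ∂(stdGaussianMat p q) = ∑ i, ∑ j, a i j ^ 2 := by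
  rw [← variance_sum_mul_stdGaussianMat,
    ProbabilityTheory.variance_of_integral_eq_zero (memLp_sum_mul_stdGaussianMat a).aemeasurable]
  obtain ⟨L, hL⟩ := exists_dual_eq_sum_mul a
  simpa only [← hL] using integral_dual_stdGaussianMat p q L

lemma integral_sq_noiseForm_le {p q : ℕ} (a b c : ℝ) (s : (Fin p → ℝ) × (Fin q → ℝ)) :
    ∫ x, noiseForm a b c s x ^ 2 ∂(noiseMeasure p q)
      ≤ 3 * (a ^ 2 * ((∑ i, s.1 i ^ 2) * ∑ j, s.2 j ^ 2) + b ^ 2 * ∑ i, s.1 i ^ 2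
        + c ^ 2 * ∑ j, s.2 j ^ 2) := by
  have h1 := (memLp_sum_mul_stdGaussianMat fun i j => a * s.1 i * s.2 j).integrable_sq.comp_fst
    ((stdGaussian p).prod (stdGaussian q))
  have h2 := ((memLp_sum_mul_stdGaussian fun i => b * s.1 i).integrable_sq.comp_fst
    (stdGaussian q)).comp_snd (stdGaussianMat p q)
  have h3 := ((memLp_sum_mul_stdGaussian fun j => c * s.2 j).integrable_sq.comp_snd
    (stdGaussian p)).comp_snd (stdGaussianMat p q)
  have e1 : ∫ x, (∑ i, ∑ j, a * s.1 i * s.2 j * x.1 i j) ^ 2 ∂(noiseMeasure p q)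
      = ∑ i, ∑ j, (a * s.1 i * s.2 j) ^ 2 := by
    rw [integral_fun_fst fun x : Fin p → Fin q → ℝ => (∑ i, ∑ j, a * s.1 i * s.2 j * x i j) ^ 2,
      integral_sq_sum_mul_stdGaussianMat]
    simp
  have e2 : ∫ x, (∑ i, b * s.1 i * x.2.1 i) ^ 2 ∂(noiseMeasure p q)
      = ∑ i, (b * s.1 i) ^ 2 := by
    rw [integral_fun_snd fun x : (Fin p → ℝ) × (Fin q → ℝ) => (∑ i, b * s.1 i * x.1 i) ^ 2,
      integral_fun_fst fun x : Fin p → ℝ => (∑ i, b * s.1 i * x i) ^ 2,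
      integral_sq_sum_mul_stdGaussian]
    simp
  have e3 : ∫ x, (∑ j, c * s.2 j * x.2.2 j) ^ 2 ∂(noiseMeasure p q)
      = ∑ j, (c * s.2 j) ^ 2 := by
    rw [integral_fun_snd fun x : (Fin p → ℝ) × (Fin q → ℝ) => (∑ j, c * s.2 j * x.2 j) ^ 2,
      integral_fun_snd fun x : Fin q → ℝ => (∑ j, c * s.2 j * x j) ^ 2,
      integral_sq_sum_mul_stdGaussian]
    simp
  calc ∫ x, noiseForm a b c s x ^ 2 ∂(noiseMeasure p q)
      ≤ ∫ x, 3 * ((∑ i, ∑ j, a * s.1 i * s.2 j * x.1 i j) ^ 2 + (∑ i, b * s.1 i * x.2.1 i) ^ 2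
          + (∑ j, c * s.2 j * x.2.2 j) ^ 2) ∂(noiseMeasure p q) := by
        refine integral_mono_of_nonneg (.of_forall fun x => sq_nonneg _)
          (((h1.add h2).add h3).const_mul 3) (.of_forall fun x => ?_)
        simp only [noiseForm_apply]
        exact sum_sq_le
    _ = 3 * ((∑ i, ∑ j, (a * s.1 i * s.2 j) ^ 2) + (∑ i, (b * s.1 i) ^ 2)
          + ∑ j, (c * s.2 j) ^ 2) := by
        rw [integral_const_mul, integral_add (by exact h1.add h2) h3, integral_add h1 h2,
          e1, e2, e3]
    _ = _ := by
        simp only [mul_pow, Finset.sum_mul_sum, mul_assoc]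
        simp only [Finset.mul_sum]

end Noise

section Rotation

/-- Simultaneous rotation of the noises by `O` on the left index and `Q` on the right index. -/
def rotateNoise {p q : ℕ} (O : Matrix (Fin p) (Fin p) ℝ) (Q : Matrix (Fin q) (Fin q) ℝ)
    (x : (Fin p → Fin q → ℝ) × (Fin p → ℝ) × (Fin q → ℝ)) :
    (Fin p → Fin q → ℝ) × (Fin p → ℝ) × (Fin q → ℝ) :=
  (fun i => Q.mulVec (∑ k, O i k • x.1 k), O.mulVec x.2.1, Q.mulVec x.2.2)

lemma measurePreserving_mulVec_stdGaussian {m : ℕ} {O : Matrix (Fin m) (Fin m) ℝ}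
    (hO : O ∈ Matrix.orthogonalGroup (Fin m) ℝ) :
    MeasurePreserving (fun x => O.mulVec x) (stdGaussian m) (stdGaussian m) :=
  ⟨by fun_prop, map_orthogonal_pi integral_dual_gaussianReal hO⟩

lemma measurePreserving_rotateNoise {p q : ℕ} {O : Matrix (Fin p) (Fin p) ℝ}
    {Q : Matrix (Fin q) (Fin q) ℝ} (hO : O ∈ Matrix.orthogonalGroup (Fin p) ℝ)
    (hQ : Q ∈ Matrix.orthogonalGroup (Fin q) ℝ) :
    MeasurePreserving (rotateNoise O Q) (noiseMeasure p q) (noiseMeasure p q) := by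
  have h1 : MeasurePreserving (fun (x : Fin p → Fin q → ℝ) i => ∑ k, O i k • x k)
      (stdGaussianMat p q) (stdGaussianMat p q) :=
    ⟨by fun_prop, map_orthogonal_pi (integral_dual_stdGaussian q) hO⟩
  have h2 : MeasurePreserving (fun (x : Fin p → Fin q → ℝ) i => Q.mulVec (x i))
      (stdGaussianMat p q) (stdGaussianMat p q) :=
    measurePreserving_pi _ _ fun _ => measurePreserving_mulVec_stdGaussian hQ
  exact (h2.comp h1).prod ((measurePreserving_mulVec_stdGaussian hO).prod
    (measurePreserving_mulVec_stdGaussian hQ))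

lemma interpH_eq_dotProduct (n p q : ℕ) (au av t Ru Rv : ℝ) (U : Fin p → ℝ) (V : Fin q → ℝ)
    (Z : Fin p → Fin q → ℝ) (Zt : Fin p → ℝ) (Zb : Fin q → ℝ) (u : Fin p → ℝ) (v : Fin q → ℝ) :
    interpH n p q au av t Ru Rv U V Z Zt Zb u v
      = ((1 - t) / (2 * n) * ((u ⬝ᵥ u) * (v ⬝ᵥ v))
          - √((1 - t) / n) * √((1 - t) / n) * ((u ⬝ᵥ U) * (v ⬝ᵥ V))
          - √((1 - t) / n) * ∑ i, u i * (v ⬝ᵥ Z i))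
        + (av * Rv / 2 * (u ⬝ᵥ u) - √(av * Rv) * √(av * Rv) * (u ⬝ᵥ U) - √(av * Rv) * (u ⬝ᵥ Zt))
        + (au * Ru / 2 * (v ⬝ᵥ v) - √(au * Ru) * √(au * Ru) * (v ⬝ᵥ V)
          - √(au * Ru) * (v ⬝ᵥ Zb)) := by
  unfold interpH
  simp only [dotProduct, Finset.sum_mul_sum]
  simp only [Finset.mul_sum, ← Finset.sum_sub_distrib]
  congr 1
  · congr 1
    · exact Finset.sum_congr rfl fun i _ => Finset.sum_congr rfl fun j _ => by ring
    · exact Finset.sum_congr rfl fun i _ => by ring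
  · exact Finset.sum_congr rfl fun i _ => by ring

lemma interpH_rotate (n : ℕ) {p q : ℕ} (au av t Ru Rv : ℝ) {O : Matrix (Fin p) (Fin p) ℝ}
    {Q : Matrix (Fin q) (Fin q) ℝ} (hO : O ∈ Matrix.orthogonalGroup (Fin p) ℝ)
    (hQ : Q ∈ Matrix.orthogonalGroup (Fin q) ℝ) (U : Fin p → ℝ) (V : Fin q → ℝ)
    (x : (Fin p → Fin q → ℝ) × (Fin p → ℝ) × (Fin q → ℝ)) (u : Fin p → ℝ) (v : Fin q → ℝ) :
    interpH n p q au av t Ru Rv (O.mulVec U) (Q.mulVec V) (rotateNoise O Q x).1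
        (rotateNoise O Q x).2.1 (rotateNoise O Q x).2.2 (O.mulVec u) (Q.mulVec v)
      = interpH n p q au av t Ru Rv U V x.1 x.2.1 x.2.2 u v := by
  have hZ : ∑ i, O.mulVec u i * (Q.mulVec v ⬝ᵥ (rotateNoise O Q x).1 i)
      = ∑ i, u i * (v ⬝ᵥ x.1 i) := by
    have h := dotProduct_orthogonal_mulVec hO u fun i => v ⬝ᵥ x.1 i
    simp only [rotateNoise, dotProduct_orthogonal_mulVec hQ]
    refine Eq.trans (Finset.sum_congr rfl fun i _ => ?_) h
    congr 1
    simp only [Matrix.mulVec, dotProduct, Finset.sum_apply, Pi.smul_apply, smul_eq_mul,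
      Finset.mul_sum]
    rw [Finset.sum_comm]
    exact Finset.sum_congr rfl fun _ _ => Finset.sum_congr rfl fun _ _ => by ring
  rw [interpH_eq_dotProduct, interpH_eq_dotProduct, hZ]
  simp only [rotateNoise, dotProduct_orthogonal_mulVec hO, dotProduct_orthogonal_mulVec hQ]

end Rotation

section FreeEntropy

variable (n : ℕ) {p q : ℕ} (au av t Ru Rv : ℝ)

lemma neg_interpH_eq_noiseForm (U : Fin p → ℝ) (V : Fin q → ℝ)
    (x : (Fin p → Fin q → ℝ) × (Fin p → ℝ) × (Fin q → ℝ)) (s : (Fin p → ℝ) × (Fin q → ℝ)) :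
    -interpH n p q au av t Ru Rv U V x.1 x.2.1 x.2.2 s.1 s.2
      = -interpH n p q au av t Ru Rv U V 0 0 0 s.1 s.2
        + noiseForm √((1 - t) / n) √(av * Rv) √(au * Ru) s x := by
  rw [interpH_eq_dotProduct, interpH_eq_dotProduct, noiseForm_apply]
  simp only [mul_assoc, ← Finset.mul_sum]
  simp [dotProduct]
  ring

lemma continuous_interpH (U : Fin p → ℝ) (V : Fin q → ℝ) (Z : Fin p → Fin q → ℝ)
    (Zt : Fin p → ℝ) (Zb : Fin q → ℝ) :
    Continuous fun s : (Fin p → ℝ) × (Fin q → ℝ) =>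
      interpH n p q au av t Ru Rv U V Z Zt Zb s.1 s.2 := by
  unfold interpH
  fun_prop

variable {ru rv : ℝ} {Pu : Measure (Fin p → ℝ)} {Pv : Measure (Fin q → ℝ)}

lemma ae_prod_mem_spheres (hPu : IsUniformSphere p ru Pu) (hPv : IsUniformSphere q rv Pv) :
    ∀ᵐ s ∂(Pu.prod Pv), s ∈ {u : Fin p → ℝ | ∑ i, u i ^ 2 = ru ^ 2} ×ˢ
      {v : Fin q → ℝ | ∑ j, v j ^ 2 = rv ^ 2} := by
  have := hPu.1
  have := hPv.1
  filter_upwards [Measure.quasiMeasurePreserving_fst.ae hPu.2.1,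
    Measure.quasiMeasurePreserving_snd.ae hPv.2.1] with s h1 h2 using ⟨h1, h2⟩

lemma log_partFun_eq_logPartition (hPu : IsUniformSphere p ru Pu) (hPv : IsUniformSphere q rv Pv)
    (U : Fin p → ℝ) (V : Fin q → ℝ) (x : (Fin p → Fin q → ℝ) × (Fin p → ℝ) × (Fin q → ℝ)) :
    log (partFun n p q au av t Ru Rv Pu Pv U V x.1 x.2.1 x.2.2)
      = logPartition (Pu.prod Pv) (fun s => -interpH n p q au av t Ru Rv U V 0 0 0 s.1 s.2)
          (noiseForm √((1 - t) / n) √(av * Rv) √(au * Ru)) x := by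
  have := hPu.1
  have := hPv.1
  unfold partFun logPartition
  simp_rw [← neg_interpH_eq_noiseForm]
  rw [integral_prod]
  exact integrable_of_continuous_of_ae_mem_compact
    ((isCompact_setOf_sum_sq_eq p ru).prod (isCompact_setOf_sum_sq_eq q rv))
    (ae_prod_mem_spheres hPu hPv) (continuous_interpH n au av t Ru Rv U V _ _ _).neg.rexp

lemma measurePreserving_mulVec_of_isUniformSphere (hPu : IsUniformSphere p ru Pu)
    {O : Matrix (Fin p) (Fin p) ℝ} (hO : O ∈ Matrix.orthogonalGroup (Fin p) ℝ) :
    MeasurePreserving (fun u => O.mulVec u) Pu Pu :=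
  ⟨by fun_prop, hPu.2.2 O hO⟩

lemma partFun_rotate (hPu : IsUniformSphere p ru Pu) (hPv : IsUniformSphere q rv Pv)
    {O : Matrix (Fin p) (Fin p) ℝ} {Q : Matrix (Fin q) (Fin q) ℝ}
    (hO : O ∈ Matrix.orthogonalGroup (Fin p) ℝ) (hQ : Q ∈ Matrix.orthogonalGroup (Fin q) ℝ)
    (U : Fin p → ℝ) (V : Fin q → ℝ) (x : (Fin p → Fin q → ℝ) × (Fin p → ℝ) × (Fin q → ℝ)) :
    partFun n p q au av t Ru Rv Pu Pv (O.mulVec U) (Q.mulVec V) (rotateNoise O Q x).1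
        (rotateNoise O Q x).2.1 (rotateNoise O Q x).2.2
      = partFun n p q au av t Ru Rv Pu Pv U V x.1 x.2.1 x.2.2 := by
  have := hPu.1
  have := hPv.1
  have hint : ∀ U V Z Zt Zb, Integrable (fun s : (Fin p → ℝ) × (Fin q → ℝ) =>
      exp (-interpH n p q au av t Ru Rv U V Z Zt Zb s.1 s.2)) (Pu.prod Pv) :=
    fun U V Z Zt Zb => integrable_of_continuous_of_ae_mem_compact
      ((isCompact_setOf_sum_sq_eq p ru).prod (isCompact_setOf_sum_sq_eq q rv))
      (ae_prod_mem_spheres hPu hPv) (continuous_interpH n au av t Ru Rv U V Z Zt Zb).neg.rexp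
  have hmp := (measurePreserving_mulVec_of_isUniformSphere hPu hO).prod
    (measurePreserving_mulVec_of_isUniformSphere hPv hQ)
  unfold partFun
  rw [← integral_prod _ (hint _ _ _ _ _), ← integral_prod _ (hint _ _ _ _ _)]
  nth_rewrite 1 [← hmp.map_eq]
  rw [integral_map hmp.aemeasurable
    (by rw [hmp.map_eq]; exact (hint _ _ _ _ _).aestronglyMeasurable)]
  simp only [Prod.map_fst, Prod.map_snd, interpH_rotate n au av t Ru Rv hO hQ]

lemma memLp_log_partFun (hPu : IsUniformSphere p ru Pu) (hPv : IsUniformSphere q rv Pv)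
    (U : Fin p → ℝ) (V : Fin q → ℝ) :
    MemLp (fun x => log (partFun n p q au av t Ru Rv Pu Pv U V x.1 x.2.1 x.2.2)) 2
      (noiseMeasure p q) := by
  have := hPu.1
  have := hPv.1
  simp_rw [log_partFun_eq_logPartition n au av t Ru Rv hPu hPv U V]
  exact memLp_logPartition ((isCompact_setOf_sum_sq_eq p ru).prod (isCompact_setOf_sum_sq_eq q rv))
    (ae_prod_mem_spheres hPu hPv) (continuous_interpH n au av t Ru Rv U V 0 0 0).neg
    (continuous_noiseForm _ _ _)

lemma variance_log_partFun_le (hPu : IsUniformSphere p ru Pu) (hPv : IsUniformSphere q rv Pv)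
    (U : Fin p → ℝ) (V : Fin q → ℝ) :
    ∫ x, (log (partFun n p q au av t Ru Rv Pu Pv U V x.1 x.2.1 x.2.2)
        - ∫ y, log (partFun n p q au av t Ru Rv Pu Pv U V y.1 y.2.1 y.2.2)
          ∂(noiseMeasure p q)) ^ 2 ∂(noiseMeasure p q)
      ≤ (π / 2) ^ 2 * (3 * (√((1 - t) / n) ^ 2 * (ru ^ 2 * rv ^ 2) + √(av * Rv) ^ 2 * ru ^ 2
        + √(au * Ru) ^ 2 * rv ^ 2)) := by
  have := hPu.1
  have := hPv.1
  simp_rw [log_partFun_eq_logPartition n au av t Ru Rv hPu hPv U V]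
  refine variance_logPartition_le (integral_dual_noiseMeasure p q)
    ((isCompact_setOf_sum_sq_eq p ru).prod (isCompact_setOf_sum_sq_eq q rv))
    (ae_prod_mem_spheres hPu hPv) (continuous_interpH n au av t Ru Rv U V 0 0 0).neg
    (continuous_noiseForm _ _ _) fun s hs => (integral_sq_noiseForm_le _ _ _ s).trans_eq ?_
  rw [show ∑ i, s.1 i ^ 2 = ru ^ 2 from hs.1, show ∑ j, s.2 j ^ 2 = rv ^ 2 from hs.2]

/-- The noise-averaged log-partition function depends on the signals only through their norms. -/
lemma integral_log_partFun_eq (hPu : IsUniformSphere p ru Pu) (hPv : IsUniformSphere q rv Pv)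
    {U U' : Fin p → ℝ} {V V' : Fin q → ℝ} (hU : U ⬝ᵥ U = U' ⬝ᵥ U') (hV : V ⬝ᵥ V = V' ⬝ᵥ V') :
    ∫ x, log (partFun n p q au av t Ru Rv Pu Pv U' V' x.1 x.2.1 x.2.2) ∂(noiseMeasure p q)
      = ∫ x, log (partFun n p q au av t Ru Rv Pu Pv U V x.1 x.2.1 x.2.2) ∂(noiseMeasure p q) := by
  obtain ⟨O, hO, rfl⟩ := exists_orthogonal_mulVec_eq hU
  obtain ⟨Q, hQ, rfl⟩ := exists_orthogonal_mulVec_eq hV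
  have hmp := measurePreserving_rotateNoise hO hQ
  nth_rewrite 1 [← hmp.map_eq]
  rw [integral_map hmp.aemeasurable (by
    rw [hmp.map_eq]
    exact (memLp_log_partFun n au av t Ru Rv hPu hPv _ _).aestronglyMeasurable)]
  simp only [partFun_rotate n au av t Ru Rv hPu hPv hO hQ]

lemma dotProduct_self_eq_sum_sq {m : ℕ} (x : Fin m → ℝ) : x ⬝ᵥ x = ∑ i, x i ^ 2 := by
  simp [dotProduct, sq]

lemma integral_integral_eq_const {X Y : Type*} [MeasurableSpace X] [MeasurableSpace Y]
    {μ : Measure X} {η : Measure Y} [IsProbabilityMeasure μ] [IsProbabilityMeasure η]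
    {f : X → Y → ℝ} {m : ℝ} (h : ∀ᵐ x ∂μ, ∀ᵐ y ∂η, f x y = m) :
    ∫ x, (∫ y, f x y ∂η) ∂μ = m := by
  have h' : ∀ᵐ x ∂μ, ∫ y, f x y ∂η = m := h.mono fun x hx => by
    rw [integral_congr_ae hx]; simp
  rw [integral_congr_ae h']; simp

lemma integral_integral_le_of_ae_le {X Y : Type*} [MeasurableSpace X] [MeasurableSpace Y]
    {μ : Measure X} {η : Measure Y} [IsProbabilityMeasure μ] [IsProbabilityMeasure η]
    {f : X → Y → ℝ} {B : ℝ} (h0 : ∀ x y, 0 ≤ f x y) (h : ∀ᵐ x ∂μ, ∀ᵐ y ∂η, f x y ≤ B) :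
    ∫ x, (∫ y, f x y ∂η) ∂μ ≤ B := by
  have h' : ∀ᵐ x ∂μ, ∫ y, f x y ∂η ≤ B := h.mono fun x hx =>
    (integral_mono_of_nonneg (.of_forall (h0 x)) (integrable_const B) hx).trans_eq (by simp)
  exact (integral_mono_of_nonneg (.of_forall fun x => integral_nonneg (h0 x))
    (integrable_const B) h').trans_eq (by simp)

lemma Efull_sq_sub_le (hPu : IsUniformSphere p ru Pu) (hPv : IsUniformSphere q rv Pv) :
    Efull p q Pu Pv (fun U V Z Zt Zb =>
        (randFreeEntropy n p q au av t Ru Rv Pu Pv U V Z Zt Zb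
          - interpFreeEntropy n p q au av t Ru Rv Pu Pv) ^ 2)
      ≤ (1 / (n : ℝ)) ^ 2 * ((π / 2) ^ 2 * (3 * (√((1 - t) / n) ^ 2 * (ru ^ 2 * rv ^ 2)
        + √(av * Rv) ^ 2 * ru ^ 2 + √(au * Ru) ^ 2 * rv ^ 2))) := by
  have := hPu.1
  have := hPv.1
  obtain ⟨U₀, hU₀⟩ := hPu.2.1.exists
  obtain ⟨V₀, hV₀⟩ := hPv.2.1.exists
  set F : (Fin p → ℝ) → (Fin q → ℝ) → (Fin p → Fin q → ℝ) × (Fin p → ℝ) × (Fin q → ℝ) → ℝ :=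
    fun U V x => log (partFun n p q au av t Ru Rv Pu Pv U V x.1 x.2.1 x.2.2) with hF
  set m := ∫ x, F U₀ V₀ x ∂(noiseMeasure p q) with hm_def
  have hF2 : ∀ U V, MemLp (F U V) 2 (noiseMeasure p q) :=
    memLp_log_partFun n au av t Ru Rv hPu hPv
  have hm : ∀ᵐ U ∂Pu, ∀ᵐ V ∂Pv, ∫ x, F U V x ∂(noiseMeasure p q) = m := by
    filter_upwards [hPu.2.1] with U hU
    filter_upwards [hPv.2.1] with V hV
    exact integral_log_partFun_eq n au av t Ru Rv hPu hPv
      (by rw [dotProduct_self_eq_sum_sq, dotProduct_self_eq_sum_sq, hU, hU₀])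
      (by rw [dotProduct_self_eq_sum_sq, dotProduct_self_eq_sum_sq, hV, hV₀])
  have hinterp : interpFreeEntropy n p q au av t Ru Rv Pu Pv = 1 / (n : ℝ) * m := by
    unfold interpFreeEntropy Efull
    congr 1
    refine integral_integral_eq_const (hm.mono fun U hU => hU.mono fun V hV => ?_)
    rw [← hV]
    exact integral_integral_integral_noise ((hF2 U V).integrable one_le_two)
  rw [hinterp]
  unfold Efull randFreeEntropy
  refine integral_integral_le_of_ae_le
    (fun U V => integral_nonneg fun Z => integral_nonneg fun Zt => integral_nonneg fun Zb =>
      sq_nonneg _) (hm.mono fun U hU => hU.mono fun V hV => ?_)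
  simp_rw [← mul_sub, mul_pow (1 / (n : ℝ)), integral_const_mul]
  refine mul_le_mul_of_nonneg_left ?_ (sq_nonneg _)
  rw [integral_integral_integral_noise (h := fun x => (F U V x - m) ^ 2)
    ((hF2 U V).sub (memLp_const m)).integrable_sq, ← hV]
  exact variance_log_partFun_le n au av t Ru Rv hPu hPv U V

end FreeEntropy

lemma exists_le_mul_of_tendsto_div {f : ℕ → ℕ} {a : ℝ}
    (hf : Tendsto (fun n => (f n : ℝ) / n) atTop (nhds a)) :
    ∃ K : ℝ, 0 ≤ K ∧ ∀ n : ℕ, 1 ≤ n → (f n : ℝ) ≤ K * n := by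
  obtain ⟨K, hK⟩ := hf.bddAbove_range
  refine ⟨K, le_trans (by positivity) (hK ⟨0, rfl⟩), fun n hn => ?_⟩
  have hn' : (0 : ℝ) < n := by exact_mod_cast hn
  exact (div_le_iff₀ hn').1 (hK ⟨n, rfl⟩)

/-- **Proposition: concentration of the free entropy.** For every
`M > 0` there exists a positive constant `C` such that for all `t ∈ [0,1]` and all
`R = (R_u,R_v) ∈ [0,∞)²` with `‖R‖ ≤ M`,
`E[(Fₙ(t,R) − E Fₙ(t,R))²] ≤ C/n`. -/
theorem free_entropy_concentration
    (au av ru rv : ℝ) (hau : 0 < au) (hav : 0 < av) (hru : 0 < ru) (hrv : 0 < rv)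
    (nuf nvf : ℕ → ℕ)
    (hnuf : Tendsto (fun n => (nuf n : ℝ) / n) atTop (nhds au))
    (hnvf : Tendsto (fun n => (nvf n : ℝ) / n) atTop (nhds av))
    (Pu : (n : ℕ) → Measure (Fin (nuf n) → ℝ))
    (Pv : (n : ℕ) → Measure (Fin (nvf n) → ℝ))
    (hPu : ∀ n, IsUniformSphere (nuf n) (Real.sqrt (ru * nuf n)) (Pu n))
    (hPv : ∀ n, IsUniformSphere (nvf n) (Real.sqrt (rv * nvf n)) (Pv n))
    (M : ℝ) (hM : 0 < M) :
    ∃ C : ℝ, 0 < C ∧ ∀ n : ℕ, 1 ≤ n → ∀ t ∈ Icc (0:ℝ) 1,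
      ∀ Ru Rv : ℝ, 0 ≤ Ru → 0 ≤ Rv → Real.sqrt (Ru ^ 2 + Rv ^ 2) ≤ M →
        Efull (nuf n) (nvf n) (Pu n) (Pv n) (fun U V Z Zt Zb =>
            (randFreeEntropy n (nuf n) (nvf n) au av t Ru Rv (Pu n) (Pv n) U V Z Zt Zb
              - interpFreeEntropy n (nuf n) (nvf n) au av t Ru Rv (Pu n) (Pv n)) ^ 2)
          ≤ C / n := by
  obtain ⟨Ku, hKu, hnu⟩ := exists_le_mul_of_tendsto_div hnuf
  obtain ⟨Kv, hKv, hnv⟩ := exists_le_mul_of_tendsto_div hnvf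
  refine ⟨(π / 2) ^ 2 * (3 * (ru * Ku * (rv * Kv) + av * M * (ru * Ku) + au * M * (rv * Kv))) + 1,
    by positivity, fun n hn t ht Ru Rv hRu hRv hR => ?_⟩
  have hn' : (0 : ℝ) < n := by exact_mod_cast hn
  have hRuM : Ru ≤ M := (le_sqrt_of_sq_le (by nlinarith)).trans hR
  have hRvM : Rv ≤ M := (le_sqrt_of_sq_le (by nlinarith)).trans hR
  have ht' : 0 ≤ 1 - t := sub_nonneg.2 ht.2
  refine (Efull_sq_sub_le n au av t Ru Rv (hPu n) (hPv n)).trans ?_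
  rw [sq_sqrt (by positivity), sq_sqrt (by positivity), sq_sqrt (by positivity),
    sq_sqrt (by positivity), sq_sqrt (by positivity)]
  have hu : ru * nuf n ≤ ru * (Ku * n) := mul_le_mul_of_nonneg_left (hnu n hn) hru.le
  have hv : rv * nvf n ≤ rv * (Kv * n) := mul_le_mul_of_nonneg_left (hnv n hn) hrv.le
  calc _ ≤ (1 / (n : ℝ)) ^ 2 * ((π / 2) ^ 2 * (3 * (1 / n * (ru * (Ku * n) * (rv * (Kv * n)))
        + av * M * (ru * (Ku * n)) + au * M * (rv * (Kv * n))))) := by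
        gcongr
        exact sub_le_self 1 ht.1
    _ = (π / 2) ^ 2 * (3 * (ru * Ku * (rv * Kv) + av * M * (ru * Ku) + au * M * (rv * Kv))) / n := by
        field_simp
    _ ≤ _ := by
        gcongr
        exact le_add_of_nonneg_right zero_le_one

end
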